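/- arXiv:2410.10828 — 6 statements merged into one kernel-verified Lean document; each statement's English description precedes it below -/
import Mathlib

section
/- Feasible rounding (granular rounding): for any ξ with ξ_e ≤ ξ < 1 and ξ > 0, and any (x,y) ∈ M_ξ, the rounded point (x, ⌊y⌉) lies in M_MILP, where ⌊y⌉ is any entrywise rounding of y to nearest integers. -/
open Matrix Finset

noncomputable section

open Classical in
/-- `ω_i`: zero if the `i`-th row of `E` is nonzero, otherwise the gcd of the
nonzero entries of the `i`-th row of `F`. -/
def omegaV {n m p : ℕ} (E : Matrix (Fin p) (Fin n) ℝ) (F : Matrix (Fin p) (Fin m) ℤ)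
    (i : Fin p) : ℕ :=
  if E i = 0 then (Finset.univ.filter fun j => F i j ≠ 0).gcd (fun j => (F i j).natAbs) else 0

/-- `⌊h_i⌋_{ω_i}`: the largest element of `ω_i ℤ` that is `≤ h_i` (equal to
`ω_i * ⌊h_i / ω_i⌋` when `ω_i ≠ 0`), with the convention `⌊h_i⌋_0 = h_i`. -/
def hFloorV {n m p : ℕ} (E : Matrix (Fin p) (Fin n) ℝ) (F : Matrix (Fin p) (Fin m) ℤ)
    (h : Fin p → ℝ) (i : Fin p) : ℝ :=
  if omegaV E F i = 0 then h i
  else (omegaV E F i : ℝ) * (⌊h i / (omegaV E F i : ℝ)⌋ : ℝ)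

/-- `ρ_i = ‖f_i‖₁`, the 1-norm of the `i`-th row of `F`. -/
def rhoV {m p : ℕ} (F : Matrix (Fin p) (Fin m) ℤ) (i : Fin p) : ℝ := ∑ j, |(F i j : ℝ)|

/-- The real matrix obtained from the integer matrix `F`. -/
def Fr {m p : ℕ} (F : Matrix (Fin p) (Fin m) ℤ) : Matrix (Fin p) (Fin m) ℝ :=
  Matrix.of fun i j => (F i j : ℝ)

/-- The threshold `ξ_e`: the maximum of `(h_i − ⌊h_i⌋_{ω_i})/ω_i` over indices with
`ω_i ≠ 0`, set to `0` if `ω = 0`. -/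
def xiE {n m p : ℕ} (E : Matrix (Fin p) (Fin n) ℝ) (F : Matrix (Fin p) (Fin m) ℤ)
    (h : Fin p → ℝ) : ℝ :=
  if hne : (Finset.univ.filter fun i => omegaV E F i ≠ 0).Nonempty then
    (Finset.univ.filter fun i => omegaV E F i ≠ 0).sup' hne
      (fun i => (h i - hFloorV E F h i) / (omegaV E F i : ℝ))
  else 0

/-- The enlarged inner parallel set `M_ξ`. -/
def Mxi {n m p : ℕ} (X : Set (Fin n → ℝ)) (E : Matrix (Fin p) (Fin n) ℝ)
    (F : Matrix (Fin p) (Fin m) ℤ) (h : Fin p → ℝ) (yl yu : Fin m → ℤ) (ξ : ℝ) :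
    Set ((Fin n → ℝ) × (Fin m → ℝ)) :=
  {w | w.1 ∈ X ∧
    (∀ i, E.mulVec w.1 i + (Fr F).mulVec w.2 i
        ≤ hFloorV E F h i + ξ * (omegaV E F i : ℝ) - rhoV F i / 2) ∧
    (∀ j, (yl j : ℝ) + (1/2 - ξ) ≤ w.2 j ∧ w.2 j ≤ (yu j : ℝ) + (ξ - 1/2))}

/-- The mixed-integer feasible set `M_MILP`. -/
def MMILP {n m p : ℕ} (X : Set (Fin n → ℝ)) (E : Matrix (Fin p) (Fin n) ℝ)
    (F : Matrix (Fin p) (Fin m) ℤ) (h : Fin p → ℝ) (yl yu : Fin m → ℤ) :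
    Set ((Fin n → ℝ) × (Fin m → ℤ)) :=
  {w | w.1 ∈ X ∧
    (∀ i, E.mulVec w.1 i + (Fr F).mulVec (fun j => (w.2 j : ℝ)) i ≤ h i) ∧
    (∀ j, yl j ≤ w.2 j ∧ w.2 j ≤ yu j)}

/-- Feasible rounding. -/
theorem feasible_rounding {n m p : ℕ} (X : Set (Fin n → ℝ)) (hXne : X.Nonempty)
    (hXc : IsCompact X) (hXconv : Convex ℝ X)
    (E : Matrix (Fin p) (Fin n) ℝ) (F : Matrix (Fin p) (Fin m) ℤ) (h : Fin p → ℝ)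
    (yl yu : Fin m → ℤ) (ξ : ℝ) (hξe : xiE E F h ≤ ξ) (hξ1 : ξ < 1) (hξ0 : 0 < ξ)
    (x : Fin n → ℝ) (y : Fin m → ℝ) (hmem : (x, y) ∈ Mxi X E F h yl yu ξ)
    (yr : Fin m → ℤ) (hround : ∀ j, |(yr j : ℝ) - y j| ≤ 1/2) :
    (x, yr) ∈ MMILP X E F h yl yu := by
  obtain ⟨hx, hrow, hbox⟩ := hmem
  refine ⟨hx, ?_, ?_⟩
  · intro i
    have h1 := hrow i
    have hdiff : (Fr F).mulVec (fun j => (yr j : ℝ)) i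
        ≤ (Fr F).mulVec y i + rhoV F i / 2 := by
      simp only [Matrix.mulVec, dotProduct, Fr, Matrix.of_apply, rhoV]
      rw [Finset.sum_div, ← Finset.sum_add_distrib]
      refine Finset.sum_le_sum fun j _ => ?_
      have h2 : (F i j : ℝ) * ((yr j : ℝ) - y j) ≤ |(F i j : ℝ)| * (1/2) :=
        (le_abs_self _).trans (by
          rw [abs_mul]
          exact mul_le_mul_of_nonneg_left (hround j) (abs_nonneg _))
      linarith
    have hsum : E.mulVec x i + (Fr F).mulVec (fun j => (yr j : ℝ)) i
        ≤ hFloorV E F h i + ξ * (omegaV E F i : ℝ) := by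
      have h1' : E.mulVec x i + (Fr F).mulVec y i
        ≤ hFloorV E F h i + ξ * (omegaV E F i : ℝ) - rhoV F i / 2 := h1
      linarith
    show E.mulVec x i + (Fr F).mulVec (fun j => (yr j : ℝ)) i ≤ h i
    by_cases hw : omegaV E F i = 0
    · simpa [hFloorV, hw] using hsum
    · have hE : E i = 0 := by
        by_contra hE
        exact hw (by simp [omegaV, hE])
      have hEx : E.mulVec x i = 0 := by
        simp [Matrix.mulVec, hE]
      have hdvd : ∀ j, (omegaV E F i : ℤ) ∣ F i j := by
        intro j
        by_cases hF : F i j = 0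
        · simp [hF]
        · rw [Int.natCast_dvd]
          simp only [omegaV, if_pos hE]
          exact Finset.gcd_dvd (by simp [hF])
      obtain ⟨k, hk⟩ : (omegaV E F i : ℤ) ∣ ∑ j, F i j * yr j :=
        Finset.dvd_sum fun j _ => (hdvd j).mul_right _
      have hFy : (Fr F).mulVec (fun j => (yr j : ℝ)) i = (omegaV E F i : ℝ) * k := by
        simp only [Matrix.mulVec, dotProduct, Fr, Matrix.of_apply]
        exact_mod_cast hk
      have hpos : (0 : ℝ) < omegaV E F i := by
        exact_mod_cast Nat.pos_of_ne_zero hw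
      rw [hEx, hFy, zero_add] at hsum ⊢
      simp only [hFloorV, if_neg hw] at hsum
      have hk1 : (k : ℝ) < ⌊h i / (omegaV E F i : ℝ)⌋ + 1 := by
        by_contra hc
        push Not at hc
        nlinarith
      have hk2 : k ≤ ⌊h i / (omegaV E F i : ℝ)⌋ := by
        have : k < ⌊h i / (omegaV E F i : ℝ)⌋ + 1 := by exact_mod_cast hk1
        omega
      have hk3 := Int.le_floor.mp hk2
      rw [le_div_iff₀ hpos] at hk3
      linarith
  · intro j
    have h1 : (yl j : ℝ) + (1/2 - ξ) ≤ y j ∧ y j ≤ (yu j : ℝ) + (ξ - 1/2) := hbox j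
    have h2 := abs_le.mp (hround j)
    have h3 : (yl j : ℝ) < yr j + 1 := by linarith [h1.1, h2.1]
    have h4 : (yr j : ℝ) < yu j + 1 := by linarith [h1.2, h2.2]
    have h5 : yl j < yr j + 1 := by exact_mod_cast h3
    have h6 : yr j < yu j + 1 := by exact_mod_cast h4
    show yl j ≤ yr j ∧ yr j ≤ yu j
    omega
end
end

section
/- Slater's condition implies granularity: suppose X is nonempty, compact, and convex, and there exists (x̄,ȳ) ∈ X × ℝ^m with g_{ξ_e}(x̄,ȳ) < 0 componentwise. Then (i) the MILP is granular, i.e., M_ξ is nonempty for some ξ ∈ [ξ_e,1); (ii) for any fixed ξ ∈ [ξ_e,1) with ξ > 0, the relaxed linear program minimize a^T x + d^T y over (x,y) ∈ X × ℝ^m subject to g_ξ(x,y) ≤ 0 has at least one solution (x*,y*); and (iii) for every such solution, (x*, ⌊y*⌉) ∈ M_MILP for any entrywise nearest-integer rounding ⌊y*⌉ of y*. -/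
open Matrix Finset

noncomputable section

/-- `g_ξ(x,y) < 0` componentwise. -/
def gNeg {n m p : ℕ} (E : Matrix (Fin p) (Fin n) ℝ) (F : Matrix (Fin p) (Fin m) ℤ)
    (h : Fin p → ℝ) (yl yu : Fin m → ℤ) (ξ : ℝ) (x : Fin n → ℝ) (y : Fin m → ℝ) : Prop :=
  (∀ i, E.mulVec x i + (Fr F).mulVec y i - hFloorV E F h i - ξ * (omegaV E F i : ℝ)
      + rhoV F i / 2 < 0) ∧
  (∀ j, y j - (yu j : ℝ) - (ξ - 1/2) < 0) ∧
  (∀ j, -y j + (yl j : ℝ) + (1/2 - ξ) < 0)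

/-- The threshold `ξ_e` is always smaller than one. -/
theorem xiE_lt_one {n m p : ℕ} (E : Matrix (Fin p) (Fin n) ℝ) (F : Matrix (Fin p) (Fin m) ℤ)
    (h : Fin p → ℝ) : xiE E F h < 1 := by
  unfold xiE
  split_ifs with hne
  · rw [Finset.sup'_lt_iff]
    intro i hi
    have hi' : omegaV E F i ≠ 0 := (Finset.mem_filter.mp hi).2
    have hpos : (0 : ℝ) < (omegaV E F i : ℝ) := by exact_mod_cast Nat.pos_of_ne_zero hi'
    rw [hFloorV, if_neg hi', div_lt_one hpos]
    have h1 := Int.lt_floor_add_one (h i / (omegaV E F i : ℝ))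
    rw [div_lt_iff₀ hpos] at h1
    linarith
  · norm_num

/-- The enlarged inner parallel sets increase with `ξ`. -/
theorem slater_mem {n m p : ℕ} {X : Set (Fin n → ℝ)}
    {E : Matrix (Fin p) (Fin n) ℝ} {F : Matrix (Fin p) (Fin m) ℤ} {h : Fin p → ℝ}
    {yl yu : Fin m → ℤ} {x : Fin n → ℝ} {y : Fin m → ℝ} (hx : x ∈ X) {ξ₀ ξ : ℝ}
    (hg : gNeg E F h yl yu ξ₀ x y) (hξ : ξ₀ ≤ ξ) : (x, y) ∈ Mxi X E F h yl yu ξ := by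
  obtain ⟨h1, h2, h3⟩ := hg
  refine ⟨hx, fun i => ?_, fun j => ⟨?_, ?_⟩⟩
  · have := h1 i
    have hw : ξ₀ * (omegaV E F i : ℝ) ≤ ξ * (omegaV E F i : ℝ) :=
      mul_le_mul_of_nonneg_right hξ (Nat.cast_nonneg _)
    dsimp only
    linarith
  · have := h3 j
    dsimp only
    linarith
  · have := h2 j
    dsimp only
    linarith

/-- `M_ξ` is compact. -/
theorem Mxi_compact {n m p : ℕ} {X : Set (Fin n → ℝ)} (hXc : IsCompact X)
    (E : Matrix (Fin p) (Fin n) ℝ) (F : Matrix (Fin p) (Fin m) ℤ) (h : Fin p → ℝ)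
    (yl yu : Fin m → ℤ) (ξ : ℝ) : IsCompact (Mxi X E F h yl yu ξ) := by
  have hK : IsCompact (X ×ˢ Set.Icc (fun j => (yl j : ℝ) + (1/2 - ξ))
      (fun j => (yu j : ℝ) + (ξ - 1/2))) := hXc.prod isCompact_Icc
  have hC : IsClosed {w : (Fin n → ℝ) × (Fin m → ℝ) |
      ∀ i, E.mulVec w.1 i + (Fr F).mulVec w.2 i
        ≤ hFloorV E F h i + ξ * (omegaV E F i : ℝ) - rhoV F i / 2} := by
    simp only [Set.ofPred_forall]
    refine isClosed_iInter fun i => isClosed_le ?_ continuous_const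
    unfold Matrix.mulVec dotProduct
    fun_prop
  have heq : Mxi X E F h yl yu ξ = (X ×ˢ Set.Icc (fun j => (yl j : ℝ) + (1/2 - ξ))
      (fun j => (yu j : ℝ) + (ξ - 1/2))) ∩ {w : (Fin n → ℝ) × (Fin m → ℝ) |
      ∀ i, E.mulVec w.1 i + (Fr F).mulVec w.2 i
        ≤ hFloorV E F h i + ξ * (omegaV E F i : ℝ) - rhoV F i / 2} := by
    ext w
    constructor
    · rintro ⟨h1, h2, h3⟩
      exact ⟨⟨h1, fun j => (h3 j).1, fun j => (h3 j).2⟩, h2⟩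
    · rintro ⟨⟨h1, h3, h4⟩, h2⟩
      exact ⟨h1, h2, fun j => ⟨h3 j, h4 j⟩⟩
  rw [heq]
  exact hK.inter_right hC

/-- Rounding any point of `M_ξ` with `ξ < 1` gives a point of `M_MILP`. -/
theorem round_mem {n m p : ℕ} {X : Set (Fin n → ℝ)}
    {E : Matrix (Fin p) (Fin n) ℝ} {F : Matrix (Fin p) (Fin m) ℤ} {h : Fin p → ℝ}
    {yl yu : Fin m → ℤ} {ξ : ℝ} (hξ : ξ < 1) {w : (Fin n → ℝ) × (Fin m → ℝ)}
    (hw : w ∈ Mxi X E F h yl yu ξ) (yr : Fin m → ℤ)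
    (hr : ∀ j, |(yr j : ℝ) - w.2 j| ≤ 1/2) : (w.1, yr) ∈ MMILP X E F h yl yu := by
  obtain ⟨h1, h2, h3⟩ := hw
  refine ⟨h1, fun i => ?_, fun j => ⟨?_, ?_⟩⟩
  · have hdiff : (Fr F).mulVec (fun j => (yr j : ℝ)) i - (Fr F).mulVec w.2 i ≤ rhoV F i / 2 := by
      simp only [Matrix.mulVec, dotProduct, Fr, Matrix.of_apply, rhoV]
      rw [← Finset.sum_sub_distrib, Finset.sum_div]
      refine Finset.sum_le_sum fun j _ => ?_
      calc (F i j : ℝ) * (yr j : ℝ) - (F i j : ℝ) * w.2 j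
          = (F i j : ℝ) * ((yr j : ℝ) - w.2 j) := by ring
        _ ≤ |(F i j : ℝ) * ((yr j : ℝ) - w.2 j)| := le_abs_self _
        _ = |(F i j : ℝ)| * |(yr j : ℝ) - w.2 j| := abs_mul _ _
        _ ≤ |(F i j : ℝ)| * (1/2) := mul_le_mul_of_nonneg_left (hr j) (abs_nonneg _)
        _ = |(F i j : ℝ)| / 2 := by ring
    have h2i := h2 i
    dsimp only
    by_cases hω : omegaV E F i = 0
    · rw [hFloorV, if_pos hω, hω] at h2i
      simp only [Nat.cast_zero, mul_zero] at h2i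
      linarith
    · have hpos : (0 : ℝ) < (omegaV E F i : ℝ) := by exact_mod_cast Nat.pos_of_ne_zero hω
      rw [hFloorV, if_neg hω] at h2i
      have hE : E i = 0 := by
        by_contra hne
        exact hω (by rw [omegaV, if_neg hne])
      have hEx : E.mulVec w.1 i = 0 := by
        simp only [Matrix.mulVec, hE, zero_dotProduct]
      have hdvd : ∀ j, ((omegaV E F i : ℕ) : ℤ) ∣ F i j := by
        intro j
        by_cases hF : F i j = 0
        · simp [hF]
        · rw [Int.natCast_dvd, omegaV, if_pos hE]
          exact Finset.gcd_dvd (Finset.mem_filter.mpr ⟨Finset.mem_univ _, hF⟩)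
      obtain ⟨k, hk⟩ : ((omegaV E F i : ℕ) : ℤ) ∣ ∑ j, F i j * yr j :=
        Finset.dvd_sum fun j _ => (hdvd j).mul_right _
      have hFk : (Fr F).mulVec (fun j => (yr j : ℝ)) i = (omegaV E F i : ℝ) * (k : ℝ) := by
        simp only [Matrix.mulVec, dotProduct, Fr, Matrix.of_apply]
        exact_mod_cast hk
      rw [hEx] at h2i ⊢
      rw [hFk] at hdiff ⊢
      set c := ⌊h i / (omegaV E F i : ℝ)⌋ with hc
      have hlt : (omegaV E F i : ℝ) * (k : ℝ) < (omegaV E F i : ℝ) * ((c : ℝ) + 1) := by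
        nlinarith
      have hkc : (k : ℝ) < (c : ℝ) + 1 := lt_of_mul_lt_mul_left hlt hpos.le
      have hkc' : k ≤ c := by
        have : k < c + 1 := by exact_mod_cast hkc
        omega
      have hfl : (k : ℝ) ≤ h i / (omegaV E F i : ℝ) :=
        le_trans (by exact_mod_cast hkc') (Int.floor_le _)
      rw [le_div_iff₀ hpos] at hfl
      linarith
  · have := (abs_le.mp (hr j)).1
    have h4 := (h3 j).1
    have : (yl j : ℝ) < (yr j : ℝ) + 1 := by linarith
    have : yl j < yr j + 1 := by exact_mod_cast this
    dsimp only
    omega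
  · have := (abs_le.mp (hr j)).2
    have h4 := (h3 j).2
    have : (yr j : ℝ) < (yu j : ℝ) + 1 := by linarith
    have : yr j < yu j + 1 := by exact_mod_cast this
    dsimp only
    omega

/-- Slater's condition implies granularity: (i) `M_ξ` is nonempty for
some `ξ ∈ [ξ_e,1)`; (ii) for any fixed `ξ ∈ [ξ_e,1)` with `ξ > 0` the relaxed LP has a
solution; (iii) rounding any such solution gives a point of `M_MILP`. -/
theorem slater_implies_granularity {n m p : ℕ} (X : Set (Fin n → ℝ)) (hXne : X.Nonempty)
    (hXc : IsCompact X) (hXconv : Convex ℝ X) (a : Fin n → ℝ) (d : Fin m → ℝ)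
    (E : Matrix (Fin p) (Fin n) ℝ) (F : Matrix (Fin p) (Fin m) ℤ) (h : Fin p → ℝ)
    (yl yu : Fin m → ℤ) (xbar : Fin n → ℝ) (ybar : Fin m → ℝ) (hxbar : xbar ∈ X)
    (hSlater : gNeg E F h yl yu (xiE E F h) xbar ybar) :
    (∃ ξ : ℝ, xiE E F h ≤ ξ ∧ ξ < 1 ∧ (Mxi X E F h yl yu ξ).Nonempty) ∧
    (∀ ξ : ℝ, xiE E F h ≤ ξ → ξ < 1 → 0 < ξ →
      (∃ w ∈ Mxi X E F h yl yu ξ, ∀ w' ∈ Mxi X E F h yl yu ξ,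
          a ⬝ᵥ w.1 + d ⬝ᵥ w.2 ≤ a ⬝ᵥ w'.1 + d ⬝ᵥ w'.2) ∧
      (∀ w ∈ Mxi X E F h yl yu ξ,
        (∀ w' ∈ Mxi X E F h yl yu ξ, a ⬝ᵥ w.1 + d ⬝ᵥ w.2 ≤ a ⬝ᵥ w'.1 + d ⬝ᵥ w'.2) →
        ∀ yr : Fin m → ℤ, (∀ j, |(yr j : ℝ) - w.2 j| ≤ 1/2) →
          (w.1, yr) ∈ MMILP X E F h yl yu)) := by
  refine ⟨⟨xiE E F h, le_rfl, xiE_lt_one E F h, _, slater_mem hxbar hSlater le_rfl⟩,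
    fun ξ hξ hξ1 _ => ⟨?_, fun w hw _ yr hr => round_mem hξ1 hw yr hr⟩⟩
  have hcont : Continuous (fun w : (Fin n → ℝ) × (Fin m → ℝ) => a ⬝ᵥ w.1 + d ⬝ᵥ w.2) := by
    unfold dotProduct
    fun_prop
  obtain ⟨w, hw, hmin⟩ := (Mxi_compact hXc E F h yl yu ξ).exists_isMinOn
    ⟨_, slater_mem hxbar hSlater hξ⟩ hcont.continuousOn
  exact ⟨w, hw, fun w' hw' => hmin hw'⟩
end
end

section
/- Constraint-violation bound for the regularized saddle point: let (ẑ_{α,δ}, λ̂_{α,δ}) be the unique saddle point of L_{α,δ}(z,λ) = c^T z + (α/2)‖z‖² + λ^T(Az − b − ν) − (δ/2)‖λ‖² over Z × ℝ^p_{≥0}. Then for every constraint row j ∈ {1,…,p}, max{0, A_j ẑ_{α,δ} − b_j − ν_j} ≤ (max_{1≤j≤p} ‖A_j‖_2) · ((c^T z̄ + (α/2)‖z̄‖² + ‖c‖·r) / (min_{1≤j≤p} (−A_j z̄ + b_j + ν_j))) · √(δ/(2α)). -/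
open Matrix Finset

noncomputable section

/-- The regularized Lagrangian `L_{α,δ}(z,λ) = cᵀz + (α/2)‖z‖² + λᵀ(Az − b − ν) − (δ/2)‖λ‖²`. -/
def Lad {N P : ℕ} (c : EuclideanSpace ℝ (Fin N)) (A : Matrix (Fin P) (Fin N) ℝ)
    (b ν : Fin P → ℝ) (α δ : ℝ) (z : EuclideanSpace ℝ (Fin N))
    (lam : EuclideanSpace ℝ (Fin P)) : ℝ :=
  c ⬝ᵥ z + α / 2 * ‖z‖ ^ 2 + lam ⬝ᵥ (A.mulVec z - b - ν) - δ / 2 * ‖lam‖ ^ 2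

theorem cvb_dot_le {n : ℕ} (x y : EuclideanSpace ℝ (Fin n)) :
    |x ⬝ᵥ y| ≤ ‖x‖ * ‖y‖ := by
  have h := abs_real_inner_le_norm x y
  have e : inner ℝ x y = x ⬝ᵥ y := by
    simp [PiLp.inner_apply, dotProduct, mul_comm]
  rwa [e] at h

theorem cvb_arith (K B m v x α δ D : ℝ) (hB : 0 ≤ B) (hm : 0 < m) (hv : 0 < v)
    (hα : 0 < α) (hδ : 0 < δ) (hK : 0 ≤ K) (hx : v = δ * x)
    (h1 : m * x + α / 4 * D ^ 2 ≤ B) (h2 : m + v ≤ K * D) :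
    v ≤ K * (B / m) * Real.sqrt (δ / (2 * α)) := by
  have hK0 : K ≠ 0 := by
    rintro rfl
    linarith
  have hKp : 0 < K := lt_of_le_of_ne hK (Ne.symm hK0)
  have h3 : 4 * (m * v) ≤ (K * D) ^ 2 := by nlinarith [sq_nonneg (m - v)]
  have h4 : (m * v) * (K ^ 2 + α * δ) ≤ δ * K ^ 2 * B := by
    have h5 := mul_le_mul_of_nonneg_left h1 (show 0 ≤ δ * K ^ 2 by positivity)
    have h6 := mul_le_mul_of_nonneg_left h3 (show 0 ≤ α * δ / 4 by positivity)
    have h7 : δ * K ^ 2 * (m * x) = K ^ 2 * (m * v) := by rw [hx]; ring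
    nlinarith
  have hq : 0 < m * v := by positivity
  have h5 : ((m * v) * (K ^ 2 + α * δ)) ^ 2 ≤ (δ * K ^ 2 * B) ^ 2 :=
    pow_le_pow_left₀ (by positivity) h4 2
  have h6 : (δ * K ^ 2) * (4 * α * (m * v) ^ 2) ≤ (δ * K ^ 2) * (δ * K ^ 2 * B ^ 2) := by
    nlinarith [mul_nonneg (sq_nonneg (m * v)) (sq_nonneg (K ^ 2 - α * δ))]
  have h7 := le_of_mul_le_mul_left h6 (by positivity)
  have h8 : v / (K * (B / m)) ≤ Real.sqrt (δ / (2 * α)) ∨ B = 0 := by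
    rcases hB.eq_or_lt with h | h
    · exact Or.inr h.symm
    left
    apply Real.le_sqrt_of_sq_le
    have e : v / (K * (B / m)) = (m * v) / (K * B) := by field_simp
    rw [e, div_pow, div_le_div_iff₀ (by positivity) (by positivity)]
    nlinarith [sq_nonneg (m * v)]
  rcases h8 with h8 | h8
  · rcases hB.eq_or_lt with h | h
    · exfalso
      rw [← h] at h7
      have : 0 < 4 * α * (m * v) ^ 2 := by positivity
      nlinarith
    · rw [div_le_iff₀ (by positivity)] at h8
      linarith
  · exfalso
    rw [h8] at h7
    have : 0 < 4 * α * (m * v) ^ 2 := by positivity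
    nlinarith

/-- Constraint-violation bound for the regularized saddle point. -/
theorem constraint_violation_bound {N P : ℕ}
    (Z : Set (EuclideanSpace ℝ (Fin N))) (hZne : Z.Nonempty) (hZc : IsCompact Z)
    (hZconv : Convex ℝ Z) (c : EuclideanSpace ℝ (Fin N))
    (A : Matrix (Fin P) (Fin N) ℝ) (b ν : Fin P → ℝ) (α δ : ℝ)
    (hα : 0 < α) (hδ : 0 < δ)
    (hP : (Finset.univ : Finset (Fin P)).Nonempty)
    (r : ℝ) (hr : IsGreatest ((fun z => ‖z‖) '' Z) r)
    (zbar : EuclideanSpace ℝ (Fin N)) (hzbarZ : zbar ∈ Z)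
    (hSlater : ∀ j, A.mulVec zbar j < b j + ν j)
    (zhat : EuclideanSpace ℝ (Fin N)) (lamhat : EuclideanSpace ℝ (Fin P))
    (hzhatZ : zhat ∈ Z) (hlamhat : ∀ k, 0 ≤ lamhat k)
    (hsaddle₁ : ∀ lam : EuclideanSpace ℝ (Fin P), (∀ k, 0 ≤ lam k) →
      Lad c A b ν α δ zhat lam ≤ Lad c A b ν α δ zhat lamhat)
    (hsaddle₂ : ∀ z ∈ Z, Lad c A b ν α δ zhat lamhat ≤ Lad c A b ν α δ z lamhat) :
    ∀ j, max 0 (A.mulVec zhat j - b j - ν j) ≤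
      (Finset.univ.sup' hP fun j => Real.sqrt (∑ k, (A j k) ^ 2)) *
        ((c ⬝ᵥ zbar + α / 2 * ‖zbar‖ ^ 2 + ‖c‖ * r) /
          (Finset.univ.inf' hP fun j => -(A.mulVec zbar j) + b j + ν j)) *
        Real.sqrt (δ / (2 * α)) := by
  set K := (Finset.univ.sup' hP fun j => Real.sqrt (∑ k, (A j k) ^ 2)) with hKdef
  set m := (Finset.univ.inf' hP fun j => -(A.mulVec zbar j) + b j + ν j) with hmdef
  set B := c ⬝ᵥ zbar + α / 2 * ‖zbar‖ ^ 2 + ‖c‖ * r with hBdef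
  have hm : 0 < m := by
    rw [hmdef, Finset.lt_inf'_iff]
    intro i _
    linarith [hSlater i]
  have hmi : ∀ i, m ≤ -(A.mulVec zbar i) + b i + ν i := fun i =>
    Finset.inf'_le (fun j => -(A.mulVec zbar j) + b j + ν j) (Finset.mem_univ i)
  have hKi : ∀ i, Real.sqrt (∑ k, (A i k) ^ 2) ≤ K := fun i =>
    Finset.le_sup' (fun j => Real.sqrt (∑ k, (A j k) ^ 2)) (Finset.mem_univ i)
  have hcz : ∀ z ∈ Z, -(‖c‖ * r) ≤ c ⬝ᵥ z := by
    intro z hz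
    have h1 : ‖z‖ ≤ r := hr.2 ⟨z, hz, rfl⟩
    have h2 := cvb_dot_le c z
    have h3 := mul_le_mul_of_nonneg_left h1 (norm_nonneg c)
    linarith [neg_abs_le (c ⬝ᵥ z)]
  have hB : 0 ≤ B := by
    have := hcz zbar hzbarZ
    have h2 : 0 ≤ α / 2 * ‖zbar‖ ^ 2 := by positivity
    linarith
  intro j
  have hK : 0 ≤ K := (Real.sqrt_nonneg _).trans (hKi j)
  apply max_le
  · positivity
  rcases le_or_gt (A.mulVec zhat j - b j - ν j) 0 with hv | hv
  · exact hv.trans (by positivity)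
  -- multiplier identity
  have hx : A.mulVec zhat j - b j - ν j = δ * lamhat j := by
    set v := A.mulVec zhat j - b j - ν j with hvdef
    have h := hsaddle₁ (lamhat + EuclideanSpace.single j (v / δ - lamhat j)) (by
      intro k
      by_cases hk : k = j
      · subst hk
        simp
        positivity
      · simpa [hk] using hlamhat k)
    have e1 : ((lamhat + EuclideanSpace.single j (v / δ - lamhat j) :
        EuclideanSpace ℝ (Fin P)) : Fin P → ℝ) ⬝ᵥ (A.mulVec zhat - b - ν)
        = lamhat ⬝ᵥ (A.mulVec zhat - b - ν) + (v / δ - lamhat j) * v := by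
      rw [hvdef]
      simp [add_dotProduct]
      ring
    have e2 : ‖lamhat + EuclideanSpace.single j (v / δ - lamhat j)‖ ^ 2
        = ‖lamhat‖ ^ 2 + 2 * ((v / δ - lamhat j) * lamhat j) + (v / δ - lamhat j) ^ 2 := by
      rw [norm_add_sq_real, EuclideanSpace.inner_single_right]
      simp
    unfold Lad at h
    rw [e1, e2] at h
    have h3 : v = δ * (v / δ) := by field_simp
    set y := v / δ
    have h4 : δ / 2 * (y - lamhat j) ^ 2 ≤ 0 := by
      rw [h3] at h
      nlinarith
    have h5 : (y - lamhat j) ^ 2 = 0 := by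
      apply le_antisymm _ (sq_nonneg _)
      by_contra hc
      push Not at hc
      have : 0 < δ / 2 * (y - lamhat j) ^ 2 := by positivity
      linarith
    have h6 : y = lamhat j := by
      have := pow_eq_zero_iff (two_ne_zero) |>.1 h5
      linarith
    rw [h3, h6]
  -- complementary term is nonnegative
  have hcs : 0 ≤ lamhat ⬝ᵥ (A.mulVec zhat - b - ν) := by
    have h := hsaddle₁ 0 (by simp)
    unfold Lad at h
    simp at h
    have : 0 ≤ δ / 2 * ‖lamhat‖ ^ 2 := by positivity
    simp
    linarith
  have hbar : lamhat ⬝ᵥ (A.mulVec zbar - b - ν) ≤ -(m * lamhat j) := by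
    have h1 : ∀ i ∈ Finset.univ, lamhat i * (A.mulVec zbar - b - ν) i ≤ -(m * lamhat i) := by
      intro i _
      have := mul_le_mul_of_nonneg_left (hmi i) (hlamhat i)
      simp only [Pi.sub_apply]
      nlinarith
    have h2 := Finset.sum_le_sum h1
    have h3 : lamhat j ≤ ∑ i, lamhat i :=
      Finset.single_le_sum (fun i _ => hlamhat i) (Finset.mem_univ j)
    rw [Finset.sum_neg_distrib, ← Finset.mul_sum] at h2
    have h4 := mul_le_mul_of_nonneg_left h3 hm.le
    unfold dotProduct
    linarith
  refine cvb_arith K B m _ (lamhat j) α δ ‖zhat - zbar‖ hB hm hv hα hδ hK hx ?_ ?_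
  · have hmid : (1 / 2 : ℝ) • zhat + (1 / 2 : ℝ) • zbar ∈ Z :=
      hZconv hzhatZ hzbarZ (by norm_num) (by norm_num) (by norm_num)
    have h := hsaddle₂ _ hmid
    have e1 : c ⬝ᵥ ((1 / 2 : ℝ) • zhat + (1 / 2 : ℝ) • zbar : EuclideanSpace ℝ (Fin N))
        = 1 / 2 * (c ⬝ᵥ zhat) + 1 / 2 * (c ⬝ᵥ zbar) := by
      simp [dotProduct_add, dotProduct_smul]
    have e2 : lamhat ⬝ᵥ (A.mulVec
          ((1 / 2 : ℝ) • zhat + (1 / 2 : ℝ) • zbar : EuclideanSpace ℝ (Fin N)) - b - ν)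
        = 1 / 2 * (lamhat ⬝ᵥ (A.mulVec zhat - b - ν))
          + 1 / 2 * (lamhat ⬝ᵥ (A.mulVec zbar - b - ν)) := by
      simp only [WithLp.ofLp_add, WithLp.ofLp_smul, mulVec_add, mulVec_smul, dotProduct_sub,
        dotProduct_add, dotProduct_smul, smul_eq_mul]
      ring
    have e3 : ‖(1 / 2 : ℝ) • zhat + (1 / 2 : ℝ) • zbar‖ ^ 2
        = 1 / 2 * ‖zhat‖ ^ 2 + 1 / 2 * ‖zbar‖ ^ 2 - 1 / 4 * ‖zhat - zbar‖ ^ 2 := by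
      rw [norm_add_sq_real, norm_sub_sq_real, norm_smul, norm_smul, inner_smul_left,
        inner_smul_right]
      norm_num
      ring
    unfold Lad at h
    rw [e1, e2, e3] at h
    have h2 := hcz zhat hzhatZ
    have h3 : 0 ≤ α / 2 * ‖zhat‖ ^ 2 := by positivity
    linarith
  · have h1 := cvb_dot_le (WithLp.toLp 2 (A j)) (zhat - zbar)
    have h2 : ‖(WithLp.toLp 2 (A j) : EuclideanSpace ℝ (Fin N))‖ ≤ K := by
      refine le_trans (le_of_eq ?_) (hKi j)
      simp [EuclideanSpace.norm_eq]
    have h3 := mul_le_mul_of_nonneg_right h2 (norm_nonneg (zhat - zbar))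
    have h4 : (WithLp.toLp 2 (A j) : EuclideanSpace ℝ (Fin N)) ⬝ᵥ (zhat - zbar)
        = A.mulVec zhat j - A.mulVec zbar j := by
      simp [dotProduct_sub, mulVec]
    simp only [WithLp.ofLp_sub] at h1 h4
    rw [h4] at h1
    have h5 := le_abs_self (A.mulVec zhat j - A.mulVec zbar j)
    have h6 := hmi j
    linarith
end
end

section
/- Dual boundedness: the dual component λ̂_κ of the unique saddle point (ẑ_κ, λ̂_κ) of L_κ over Z × ℝ^p_{≥0} satisfies ‖λ̂_κ‖_1 ≤ (c^T z̄ + (α/2)‖z̄‖² + ‖c‖·r) / (min_{1≤j≤p} (−A_j z̄ + b_j + ν_j − φ)); that is, λ̂_κ ∈ Λ = {λ ∈ ℝ^p_{≥0} : ‖λ‖_1 ≤ (c^T z̄ + (α/2)‖z̄‖² + ‖c‖·r) / (min_{1≤j≤p} (−A_j z̄ + b_j + ν_j − φ))}. -/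
open Matrix Finset

noncomputable section

/-- The tightened regularized Lagrangian
`L_κ(z,λ) = cᵀz + (α/2)‖z‖² + λᵀ(Az − b − ν + φ·𝟏) − (δ/2)‖λ‖²`. -/
def Lk {N P : ℕ} (c : EuclideanSpace ℝ (Fin N)) (A : Matrix (Fin P) (Fin N) ℝ)
    (b ν : Fin P → ℝ) (α δ φ : ℝ) (z : EuclideanSpace ℝ (Fin N))
    (lam : EuclideanSpace ℝ (Fin P)) : ℝ :=
  c ⬝ᵥ z + α / 2 * ‖z‖ ^ 2 + lam ⬝ᵥ (A.mulVec z - b - ν + fun _ => φ) - δ / 2 * ‖lam‖ ^ 2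

/-- Dual boundedness: the dual component `λ̂_κ` of the unique saddle
point of `L_κ` over `Z × ℝ^P_{≥0}` satisfies
`‖λ̂_κ‖₁ ≤ (cᵀz̄ + (α/2)‖z̄‖² + ‖c‖·r) / min_j(−A_j z̄ + b_j + ν_j − φ)`. -/
theorem dual_boundedness {N P : ℕ}
    (Z : Set (EuclideanSpace ℝ (Fin N))) (hZne : Z.Nonempty) (hZc : IsCompact Z)
    (hZconv : Convex ℝ Z) (c : EuclideanSpace ℝ (Fin N))
    (A : Matrix (Fin P) (Fin N) ℝ) (b ν : Fin P → ℝ) (α δ φ : ℝ)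
    (hα : 0 < α) (hδ : 0 < δ) (hφ : 0 ≤ φ)
    (hP : (Finset.univ : Finset (Fin P)).Nonempty)
    (r : ℝ) (hr : IsGreatest ((fun z => ‖z‖) '' Z) r)
    (zbar : EuclideanSpace ℝ (Fin N)) (hzbarZ : zbar ∈ Z)
    (hSlater : ∀ j, A.mulVec zbar j < b j + ν j - φ)
    (zhat : EuclideanSpace ℝ (Fin N)) (lamhat : EuclideanSpace ℝ (Fin P))
    (hzhatZ : zhat ∈ Z) (hlamhat : ∀ k, 0 ≤ lamhat k)
    (hsaddle₁ : ∀ lam : EuclideanSpace ℝ (Fin P), (∀ k, 0 ≤ lam k) →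
      Lk c A b ν α δ φ zhat lam ≤ Lk c A b ν α δ φ zhat lamhat)
    (hsaddle₂ : ∀ z ∈ Z, Lk c A b ν α δ φ zhat lamhat ≤ Lk c A b ν α δ φ z lamhat) :
    ∑ k, |lamhat k| ≤
      (c ⬝ᵥ zbar + α / 2 * ‖zbar‖ ^ 2 + ‖c‖ * r) /
        (Finset.univ.inf' hP fun j => -(A.mulVec zbar j) + b j + ν j - φ) := by
  have h1 := (hsaddle₁ 0 (fun k => by simp)).trans (hsaddle₂ zbar hzbarZ)
  set m := Finset.univ.inf' hP fun j => -(A.mulVec zbar j) + b j + ν j - φ with hm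
  have hmpos : 0 < m := by
    rw [hm, Finset.lt_inf'_iff]
    intro j _
    have := hSlater j
    linarith
  have hzr : ‖zhat‖ ≤ r := hr.2 ⟨zhat, hzhatZ, rfl⟩
  have hcz : -(‖c‖ * r) ≤ c ⬝ᵥ zhat := by
    have h2 : c ⬝ᵥ zhat = inner ℝ c zhat := by
      simp [PiLp.inner_apply, dotProduct, mul_comm]
    have h3 := abs_real_inner_le_norm c zhat
    have h4 := mul_le_mul_of_nonneg_left hzr (norm_nonneg c)
    rw [h2]
    linarith [neg_abs_le (inner ℝ c zhat)]
  have hdot : lamhat ⬝ᵥ (A.mulVec zbar - b - ν + fun _ => φ) ≤ -((∑ k, |lamhat k|) * m) := by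
    rw [dotProduct, Finset.sum_mul, ← Finset.sum_neg_distrib]
    refine Finset.sum_le_sum fun j _ => ?_
    have h5 : m ≤ -(A.mulVec zbar j) + b j + ν j - φ :=
      Finset.inf'_le (fun j => -(A.mulVec zbar j) + b j + ν j - φ) (Finset.mem_univ j)
    rw [abs_of_nonneg (hlamhat j)]
    have h6 := mul_le_mul_of_nonneg_left h5 (hlamhat j)
    simp only [Pi.add_apply, Pi.sub_apply]
    linarith
  have h0 : Lk c A b ν α δ φ zhat 0 = c ⬝ᵥ zhat + α / 2 * ‖zhat‖ ^ 2 := by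
    simp [Lk]
  rw [h0, Lk] at h1
  rw [le_div_iff₀ hmpos]
  have h7 : 0 ≤ α / 2 * ‖zhat‖ ^ 2 := by positivity
  have h8 : 0 ≤ δ / 2 * ‖lamhat‖ ^ 2 := by positivity
  linarith
end
end

section
/- Feasibility of the rounded regularized saddle point: let φ be set equal to the constraint-violation bound (max_{1≤j≤p} ‖A_j‖_2) · ((c^T z̄ + (α/2)‖z̄‖² + ‖c‖·r)/(min_{1≤j≤p}(−A_j z̄ + b_j + ν_j))) · √(δ/(2α)), and assume the tightened constraints admit a Slater point, i.e., min_{1≤j≤p}(−A_j z̄ + b_j + ν_j − φ) > 0. Let (ẑ_κ, λ̂_κ) be the unique saddle point of L_κ over Z × ℝ^p_{≥0}, and write ẑ_κ = (x̂_κ, ŷ_κ) ∈ X × Y_ξ. Then ẑ_κ ∈ M_ξ, and hence the rounded point (x̂_κ, ⌊ŷ_κ⌉) lies in M_MILP for any entrywise nearest-integer rounding ⌊ŷ_κ⌉. -/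
open Matrix Finset

noncomputable section

/-- The box `Y_ξ = {y : y^ℓ + (1/2−ξ)·𝟏 ≤ y ≤ y^u + (ξ−1/2)·𝟏}`. -/
def Yxi {m : ℕ} (yl yu : Fin m → ℤ) (ξ : ℝ) : Set (Fin m → ℝ) :=
  {y | ∀ j, (yl j : ℝ) + (1/2 - ξ) ≤ y j ∧ y j ≤ (yu j : ℝ) + (ξ - 1/2)}

/-- The tightened regularized Lagrangian on the product space,
`L_κ((x,y),λ) = cᵀz + (α/2)‖z‖² + λᵀ(Az − b − ν + φ·𝟏) − (δ/2)‖λ‖²`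
with `c = (a;d)`, `A = (E F)`, and Euclidean norms written as explicit sums. -/
def Lkprod {n m p : ℕ} (a : Fin n → ℝ) (d : Fin m → ℝ) (E : Matrix (Fin p) (Fin n) ℝ)
    (F : Matrix (Fin p) (Fin m) ℤ) (b ν : Fin p → ℝ) (α δ φ : ℝ)
    (w : (Fin n → ℝ) × (Fin m → ℝ)) (lam : Fin p → ℝ) : ℝ :=
  a ⬝ᵥ w.1 + d ⬝ᵥ w.2 + α / 2 * (∑ i, w.1 i ^ 2 + ∑ j, w.2 j ^ 2)
    + ∑ k, lam k * (E.mulVec w.1 k + (Fr F).mulVec w.2 k - b k - ν k + φ)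
    - δ / 2 * ∑ k, lam k ^ 2

lemma aux_scalar (G N s φ q v l D α δ : ℝ) (hα : 0 < α) (hq : 0 < q) (hδq : δ = 2 * α * q ^ 2)
    (hG : 0 ≤ G) (hN : 0 ≤ N) (hs : 0 < s) (hφ : φ = G * (N / s) * q) (hφs : φ < s)
    (hv : φ < v) (hl : δ * l = v) (h1 : v + s - φ ≤ G * D)
    (h2 : l * (v + s - φ) + α / 2 * D ^ 2 ≤ N) : False := by
  have hφ0 : 0 ≤ φ := by rw [hφ]; positivity
  have hps : φ * s = G * N * q := by rw [hφ]; field_simp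
  have hGD : s < G * D := by linarith
  have hδ : 0 < δ := by rw [hδq]; positivity
  have hl0 : 0 < l := by
    by_contra hc
    nlinarith
  have hGpos : 0 < G := by
    rcases hG.eq_or_lt with h | h
    · rw [← h] at hGD; linarith
    · exact h
  have hD2 : s ^ 2 < G ^ 2 * D ^ 2 := by nlinarith
  have hls : l * s ≤ l * (v + s - φ) := by nlinarith
  have hlφ : φ * s ≤ δ * (l * s) := by nlinarith
  have hss : φ * s ≤ s ^ 2 := by nlinarith
  -- G N ≤ 2 α q (l s)
  have e1 : G * N ≤ 2 * α * q * (l * s) := by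
    have : q * (G * N) ≤ q * (2 * α * q * (l * s)) := by
      rw [hδq] at hlφ; nlinarith
    exact le_of_mul_le_mul_left this hq
  have e2 : G ^ 2 * (l * s) + α / 2 * s ^ 2 < G ^ 2 * N := by
    have : α / 2 * s ^ 2 < α / 2 * (G ^ 2 * D ^ 2) := by gcongr
    have : G ^ 2 * (l * s + α / 2 * D ^ 2) ≤ G ^ 2 * N := by gcongr; linarith
    nlinarith
  have e3 : G ^ 2 * (l * s) + α / 2 * (G * N * q) < G ^ 2 * N := by
    have : α / 2 * (φ * s) ≤ α / 2 * s ^ 2 := by gcongr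
    rw [hps] at this; linarith
  have e4 : G ^ 2 * (G * N) + 2 * α * q * (α / 2 * (G * N * q)) < 2 * α * q * (G ^ 2 * N) := by
    have a1 : G ^ 2 * (G * N) ≤ G ^ 2 * (2 * α * q * (l * s)) := by gcongr
    have a2 : 2 * α * q * (G ^ 2 * (l * s) + α / 2 * (G * N * q)) < 2 * α * q * (G ^ 2 * N) := by
      gcongr
    linarith
  have e5 : 0 ≤ G * N * (G - α * q) ^ 2 := by positivity
  linarith

lemma aux_cs {n m : ℕ} (a x : Fin n → ℝ) (d y : Fin m → ℝ) :
    |∑ i, a i * x i + ∑ j, d j * y j| ≤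
      Real.sqrt (∑ i, a i ^ 2 + ∑ j, d j ^ 2) * Real.sqrt (∑ i, x i ^ 2 + ∑ j, y j ^ 2) := by
  have := Finset.sum_mul_sq_le_sq_mul_sq Finset.univ (Sum.elim a d) (Sum.elim x y)
  simp only [Fintype.sum_sum_type, Sum.elim_inl, Sum.elim_inr] at this
  rw [← Real.sqrt_mul (by positivity)]
  exact Real.abs_le_sqrt this

lemma aux_lam {p : ℕ} (v lam : Fin p → ℝ) (C δ : ℝ) (hδ : 0 < δ) (hl : ∀ k, 0 ≤ lam k)
    (H : ∀ l : Fin p → ℝ, (∀ k, 0 ≤ l k) →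
      C + ∑ k, l k * v k - δ / 2 * ∑ k, l k ^ 2 ≤
      C + ∑ k, lam k * v k - δ / 2 * ∑ k, lam k ^ 2) (k : Fin p) :
    0 ≤ lam k * v k ∧ (0 < v k → δ * lam k = v k) := by
  have key : ∀ t : ℝ, 0 ≤ t → t * v k - δ / 2 * t ^ 2 ≤ lam k * v k - δ / 2 * lam k ^ 2 := by
    intro t ht
    have h1 := H (Function.update lam k t) (by
      intro j
      by_cases hj : j = k
      · subst hj; simpa using ht
      · simpa [hj] using hl j)
    rw [← Finset.add_sum_erase _ _ (Finset.mem_univ k),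
      ← Finset.add_sum_erase _ (fun j => Function.update lam k t j ^ 2) (Finset.mem_univ k),
      ← Finset.add_sum_erase _ (fun j => lam j * v j) (Finset.mem_univ k),
      ← Finset.add_sum_erase _ (fun j => lam j ^ 2) (Finset.mem_univ k)] at h1
    have s1 : ∑ j ∈ Finset.univ.erase k, Function.update lam k t j * v j
        = ∑ j ∈ Finset.univ.erase k, lam j * v j :=
      Finset.sum_congr rfl fun j hj => by rw [Function.update_of_ne (Finset.ne_of_mem_erase hj)]
    have s2 : ∑ j ∈ Finset.univ.erase k, Function.update lam k t j ^ 2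
        = ∑ j ∈ Finset.univ.erase k, lam j ^ 2 :=
      Finset.sum_congr rfl fun j hj => by rw [Function.update_of_ne (Finset.ne_of_mem_erase hj)]
    rw [s1, s2] at h1
    simp only [Function.update_self] at h1
    linarith
  constructor
  · have := key 0 le_rfl
    nlinarith [sq_nonneg (lam k)]
  · intro hv
    have := key (v k / δ) (by positivity)
    have e : v k / δ * v k - δ / 2 * (v k / δ) ^ 2 = v k ^ 2 / (2 * δ) := by field_simp; ring
    rw [e, div_le_iff₀ (by positivity)] at this
    have : (δ * lam k - v k) ^ 2 ≤ 0 := by nlinarith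
    have := pow_eq_zero_iff (two_ne_zero) |>.1 (le_antisymm this (sq_nonneg _))
    linarith

lemma aux_strong {n m p : ℕ} (a : Fin n → ℝ) (d : Fin m → ℝ) (E : Matrix (Fin p) (Fin n) ℝ)
    (F : Matrix (Fin p) (Fin m) ℤ) (b ν : Fin p → ℝ) (α δ φ : ℝ)
    (x x' : Fin n → ℝ) (y y' : Fin m → ℝ) (lam : Fin p → ℝ)
    (H : ∀ t : ℝ, 0 < t → t ≤ 1 → Lkprod a d E F b ν α δ φ (x, y) lam ≤
      Lkprod a d E F b ν α δ φ ((1 - t) • x + t • x', (1 - t) • y + t • y') lam) :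
    Lkprod a d E F b ν α δ φ (x, y) lam
      + α / 2 * (∑ i, (x' i - x i) ^ 2 + ∑ j, (y' j - y j) ^ 2)
      ≤ Lkprod a d E F b ν α δ φ (x', y') lam := by
  have key : ∀ t : ℝ, Lkprod a d E F b ν α δ φ ((1 - t) • x + t • x', (1 - t) • y + t • y') lam
      = (1 - t) * Lkprod a d E F b ν α δ φ (x, y) lam + t * Lkprod a d E F b ν α δ φ (x', y') lam
        - α / 2 * (t * (1 - t)) * (∑ i, (x' i - x i) ^ 2 + ∑ j, (y' j - y j) ^ 2) := by
    intro t
    have q1 : ∑ i, ((1 - t) • x + t • x') i ^ 2 = (1 - t) * ∑ i, x i ^ 2 + t * ∑ i, x' i ^ 2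
        - t * (1 - t) * ∑ i, (x' i - x i) ^ 2 := by
      simp only [Finset.mul_sum, ← Finset.sum_add_distrib, ← Finset.sum_sub_distrib]
      refine Finset.sum_congr rfl fun i _ => ?_
      simp only [Pi.add_apply, Pi.smul_apply, smul_eq_mul]; ring
    have q2 : ∑ i, ((1 - t) • y + t • y') i ^ 2 = (1 - t) * ∑ i, y i ^ 2 + t * ∑ i, y' i ^ 2
        - t * (1 - t) * ∑ i, (y' i - y i) ^ 2 := by
      simp only [Finset.mul_sum, ← Finset.sum_add_distrib, ← Finset.sum_sub_distrib]
      refine Finset.sum_congr rfl fun i _ => ?_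
      simp only [Pi.add_apply, Pi.smul_apply, smul_eq_mul]; ring
    have q3 : ∑ k, lam k * (E.mulVec ((1 - t) • x + t • x') k
          + (Fr F).mulVec ((1 - t) • y + t • y') k - b k - ν k + φ)
        = (1 - t) * ∑ k, lam k * (E.mulVec x k + (Fr F).mulVec y k - b k - ν k + φ)
          + t * ∑ k, lam k * (E.mulVec x' k + (Fr F).mulVec y' k - b k - ν k + φ) := by
      simp only [Finset.mul_sum, ← Finset.sum_add_distrib]
      refine Finset.sum_congr rfl fun i _ => ?_
      simp only [Matrix.mulVec_add, Matrix.mulVec_smul, Pi.add_apply, Pi.smul_apply, smul_eq_mul]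
      ring
    simp only [Lkprod, q1, q2, q3, dotProduct_add, dotProduct_smul, smul_eq_mul]
    ring
  set Q := ∑ i, (x' i - x i) ^ 2 + ∑ j, (y' j - y j) ^ 2
  set L := Lkprod a d E F b ν α δ φ (x, y) lam
  set L' := Lkprod a d E F b ν α δ φ (x', y') lam
  have H2 : ∀ t : ℝ, 0 < t → t ≤ 1 → L + α / 2 * Q ≤ L' + t * (α / 2 * Q) := by
    intro t ht ht1
    have h1 := H t ht ht1
    rw [key t] at h1
    have : t * (L + α / 2 * Q) ≤ t * (L' + t * (α / 2 * Q)) := by nlinarith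
    exact le_of_mul_le_mul_left this ht
  have hT : Filter.Tendsto (fun t : ℝ => L' + t * (α / 2 * Q)) (nhdsWithin 0 (Set.Ioi 0))
      (nhds (L' + 0 * (α / 2 * Q))) := by
    apply Filter.Tendsto.mono_left _ nhdsWithin_le_nhds
    exact (Continuous.tendsto (by fun_prop) 0)
  have := ge_of_tendsto hT (b := L + α / 2 * Q) (by
    filter_upwards [Ioc_mem_nhdsGT (zero_lt_one' ℝ)] with t ht
    exact H2 t ht.1 ht.2)
  linarith

lemma aux_round {n m p : ℕ} (X : Set (Fin n → ℝ))
    (E : Matrix (Fin p) (Fin n) ℝ) (F : Matrix (Fin p) (Fin m) ℤ) (h : Fin p → ℝ)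
    (yl yu : Fin m → ℤ) (ξ : ℝ) (hξ1 : ξ < 1)
    (z : (Fin n → ℝ) × (Fin m → ℝ)) (hz : z ∈ Mxi X E F h yl yu ξ)
    (yr : Fin m → ℤ) (hyr : ∀ j, |(yr j : ℝ) - z.2 j| ≤ 1 / 2) :
    (z.1, yr) ∈ MMILP X E F h yl yu := by
  obtain ⟨hx, hc, hbox⟩ := hz
  refine ⟨hx, fun i => ?_, fun j => ?_⟩
  · have h1 := hc i
    have h2 : (Fr F).mulVec (fun j => (yr j : ℝ)) i ≤ (Fr F).mulVec z.2 i + rhoV F i / 2 := by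
      simp only [Matrix.mulVec, dotProduct, Fr, Matrix.of_apply, rhoV, Finset.sum_div,
        ← Finset.sum_add_distrib]
      refine Finset.sum_le_sum fun j _ => ?_
      have : (F i j : ℝ) * ((yr j : ℝ) - z.2 j) ≤ |(F i j : ℝ)| * (1 / 2) :=
        (le_abs_self _).trans (by rw [abs_mul]; exact mul_le_mul_of_nonneg_left (hyr j) (abs_nonneg _))
      linarith
    by_cases hω : omegaV E F i = 0
    · simp only [hFloorV, hω, if_true, Nat.cast_zero] at h1
      show E.mulVec z.1 i + _ ≤ _
      linarith
    · have hE : E i = 0 := by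
        by_contra hE
        exact hω (by simp [omegaV, hE])
      have hEx : E.mulVec z.1 i = 0 := by simp [Matrix.mulVec, hE]
      have hdvd : ∀ j, (omegaV E F i : ℤ) ∣ F i j := by
        intro j
        by_cases hj : F i j = 0
        · simp [hj]
        · rw [Int.natCast_dvd]
          simp only [omegaV, hE, if_true]
          exact Finset.gcd_dvd (by simp [hj])
      obtain ⟨k, hk⟩ : (omegaV E F i : ℤ) ∣ ∑ j, F i j * yr j :=
        Finset.dvd_sum fun j _ => (hdvd j).mul_right _
      have hFy : (Fr F).mulVec (fun j => (yr j : ℝ)) i = (omegaV E F i : ℝ) * k := by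
        simp only [Matrix.mulVec, dotProduct, Fr, Matrix.of_apply]
        exact_mod_cast hk
      have hωpos : (0 : ℝ) < omegaV E F i := by exact_mod_cast Nat.pos_of_ne_zero hω
      simp only [hFloorV, hω, if_false] at h1
      show E.mulVec z.1 i + _ ≤ _
      rw [hEx] at h1 ⊢
      rw [hFy] at h2 ⊢
      have h3 : (omegaV E F i : ℝ) * k < omegaV E F i * (⌊h i / (omegaV E F i : ℝ)⌋ + 1 : ℝ) := by
        nlinarith
      have h4 : (k : ℝ) < ⌊h i / (omegaV E F i : ℝ)⌋ + 1 := lt_of_mul_lt_mul_left h3 hωpos.le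
      have h5 : k ≤ ⌊h i / (omegaV E F i : ℝ)⌋ := by
        have : k < ⌊h i / (omegaV E F i : ℝ)⌋ + 1 := by exact_mod_cast h4
        omega
      have h6 : (k : ℝ) ≤ h i / (omegaV E F i : ℝ) := Int.le_floor.1 h5
      rw [le_div_iff₀ hωpos] at h6
      linarith
  · have h1 := abs_le.1 (hyr j)
    have h2 := hbox j
    constructor
    · have : (yl j : ℝ) < yr j + 1 := by linarith
      have : yl j < yr j + 1 := by exact_mod_cast this
      show yl j ≤ yr j
      omega
    · have : (yr j : ℝ) < yu j + 1 := by linarith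
      have : yr j < yu j + 1 := by exact_mod_cast this
      show yr j ≤ yu j
      omega

/-- Feasibility of the rounded regularized saddle point: with `φ` set to
the constraint-violation bound and a Slater point for the tightened constraints, the
primal component `ẑ_κ` of the unique saddle point of `L_κ` lies in `M_ξ`, and hence any
entrywise nearest-integer rounding of it lies in `M_MILP`. -/
theorem rounded_saddle_feasible {n m p : ℕ} (X : Set (Fin n → ℝ)) (hXne : X.Nonempty)
    (hXc : IsCompact X) (hXconv : Convex ℝ X) (a : Fin n → ℝ) (d : Fin m → ℝ)
    (E : Matrix (Fin p) (Fin n) ℝ) (F : Matrix (Fin p) (Fin m) ℤ) (h : Fin p → ℝ)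
    (yl yu : Fin m → ℤ)
    (hP : (Finset.univ : Finset (Fin p)).Nonempty)
    (ξ : ℝ) (hξe : xiE E F h ≤ ξ) (hξ1 : ξ < 1) (hξ0 : 0 < ξ)
    (b ν : Fin p → ℝ) (hb : b = hFloorV E F h)
    (hν : ν = fun k => ξ * (omegaV E F k : ℝ) - rhoV F k / 2)
    (α δ φ : ℝ) (hα : 0 < α) (hδ : 0 < δ)
    (r : ℝ)
    (hr : IsGreatest
      ((fun w => Real.sqrt (∑ i, w.1 i ^ 2 + ∑ j, w.2 j ^ 2)) '' (X ×ˢ Yxi yl yu ξ)) r)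
    (xbar : Fin n → ℝ) (ybar : Fin m → ℝ) (hzbar : (xbar, ybar) ∈ X ×ˢ Yxi yl yu ξ)
    (hSlater : ∀ k, E.mulVec xbar k + (Fr F).mulVec ybar k < b k + ν k)
    -- φ is set equal to the constraint-violation bound:
    (hφ : φ = (Finset.univ.sup' hP fun k =>
          Real.sqrt (∑ i, (E k i) ^ 2 + ∑ j, ((F k j : ℝ)) ^ 2)) *
        ((a ⬝ᵥ xbar + d ⬝ᵥ ybar + α / 2 * (∑ i, xbar i ^ 2 + ∑ j, ybar j ^ 2)
            + Real.sqrt (∑ i, a i ^ 2 + ∑ j, d j ^ 2) * r) /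
          (Finset.univ.inf' hP fun k =>
            -(E.mulVec xbar k + (Fr F).mulVec ybar k) + b k + ν k)) *
        Real.sqrt (δ / (2 * α)))
    -- the tightened constraints admit a Slater point:
    (hSlaterTight : ∀ k, E.mulVec xbar k + (Fr F).mulVec ybar k < b k + ν k - φ)
    -- (ẑ_κ, λ̂_κ) is a saddle point of L_κ over Z × ℝ^p_{≥0}:
    (zhat : (Fin n → ℝ) × (Fin m → ℝ)) (lamhat : Fin p → ℝ)
    (hzhatZ : zhat ∈ X ×ˢ Yxi yl yu ξ) (hlamhat : ∀ k, 0 ≤ lamhat k)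
    (hsaddle₁ : ∀ lam : Fin p → ℝ, (∀ k, 0 ≤ lam k) →
      Lkprod a d E F b ν α δ φ zhat lam ≤ Lkprod a d E F b ν α δ φ zhat lamhat)
    (hsaddle₂ : ∀ w ∈ X ×ˢ Yxi yl yu ξ,
      Lkprod a d E F b ν α δ φ zhat lamhat ≤ Lkprod a d E F b ν α δ φ w lamhat) :
    zhat ∈ Mxi X E F h yl yu ξ ∧
    ∀ yr : Fin m → ℤ, (∀ j, |(yr j : ℝ) - zhat.2 j| ≤ 1/2) →
      (zhat.1, yr) ∈ MMILP X E F h yl yu := by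
  have hM : zhat ∈ Mxi X E F h yl yu ξ := by
    obtain ⟨x, y⟩ := zhat
    refine ⟨hzhatZ.1, ?_, hzhatZ.2⟩
    intro k
    show E.mulVec x k + (Fr F).mulVec y k ≤ _
    have hbk : b k + ν k = hFloorV E F h k + ξ * (omegaV E F k : ℝ) - rhoV F k / 2 := by
      rw [hb, hν]; ring
    rw [← hbk]
    by_contra hcon
    push Not at hcon
    have hYconv : Convex ℝ (Yxi yl yu ξ) := by
      intro u hu v hv s t hs ht hst j
      have h1 := hu j
      have h2 := hv j
      simp only [Pi.add_apply, Pi.smul_apply, smul_eq_mul]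
      have hs' : s = 1 - t := by linarith
      subst hs'
      constructor <;> nlinarith
    have hstrong := aux_strong a d E F b ν α δ φ x xbar y ybar lamhat (by
      intro t ht ht1
      apply hsaddle₂
      exact ⟨hXconv hzhatZ.1 hzbar.1 (by linarith) ht.le (by ring),
        hYconv hzhatZ.2 hzbar.2 (by linarith) ht.le (by ring)⟩)
    have hlam := aux_lam
      (fun k => E.mulVec x k + (Fr F).mulVec y k - b k - ν k + φ) lamhat
      (a ⬝ᵥ x + d ⬝ᵥ y + α / 2 * (∑ i, x i ^ 2 + ∑ j, y j ^ 2)) δ hδ hlamhat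
      (fun l hl => hsaddle₁ l hl)
    have hr1 : Real.sqrt (∑ i, x i ^ 2 + ∑ j, y j ^ 2) ≤ r := hr.2 ⟨(x, y), hzhatZ, rfl⟩
    have hr2 : Real.sqrt (∑ i, xbar i ^ 2 + ∑ j, ybar j ^ 2) ≤ r :=
      hr.2 ⟨(xbar, ybar), hzbar, rfl⟩
    have hc1 : -(Real.sqrt (∑ i, a i ^ 2 + ∑ j, d j ^ 2) * r) ≤ a ⬝ᵥ x + d ⬝ᵥ y := by
      have h1 := (abs_le.1 (aux_cs a x d y)).1
      have h2 := mul_le_mul_of_nonneg_left hr1 (Real.sqrt_nonneg (∑ i, a i ^ 2 + ∑ j, d j ^ 2))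
      simp only [dotProduct]
      linarith
    have hc2 : -(Real.sqrt (∑ i, a i ^ 2 + ∑ j, d j ^ 2) * r) ≤ a ⬝ᵥ xbar + d ⬝ᵥ ybar := by
      have h1 := (abs_le.1 (aux_cs a xbar d ybar)).1
      have h2 := mul_le_mul_of_nonneg_left hr2 (Real.sqrt_nonneg (∑ i, a i ^ 2 + ∑ j, d j ^ 2))
      simp only [dotProduct]
      linarith
    have hGk : Real.sqrt (∑ i, (E k i) ^ 2 + ∑ j, ((F k j : ℝ)) ^ 2) ≤
        (Finset.univ.sup' hP fun k => Real.sqrt (∑ i, (E k i) ^ 2 + ∑ j, ((F k j : ℝ)) ^ 2)) :=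
      Finset.le_sup' (fun k => Real.sqrt (∑ i, (E k i) ^ 2 + ∑ j, ((F k j : ℝ)) ^ 2))
        (Finset.mem_univ k)
    have hsk : (Finset.univ.inf' hP fun k =>
            -(E.mulVec xbar k + (Fr F).mulVec ybar k) + b k + ν k) ≤
        -(E.mulVec xbar k + (Fr F).mulVec ybar k) + b k + ν k :=
      Finset.inf'_le (fun k => -(E.mulVec xbar k + (Fr F).mulVec ybar k) + b k + ν k)
        (Finset.mem_univ k)
    have hs0 : 0 < (Finset.univ.inf' hP fun k =>
            -(E.mulVec xbar k + (Fr F).mulVec ybar k) + b k + ν k) := by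
      rw [Finset.lt_inf'_iff]
      intro i _
      have := hSlater i
      linarith
    have hsφ : φ < (Finset.univ.inf' hP fun k =>
            -(E.mulVec xbar k + (Fr F).mulVec ybar k) + b k + ν k) := by
      rw [Finset.lt_inf'_iff]
      intro i _
      have := hSlaterTight i
      linarith
    generalize (Finset.univ.sup' hP fun k =>
      Real.sqrt (∑ i, (E k i) ^ 2 + ∑ j, ((F k j : ℝ)) ^ 2)) = G at hφ hGk
    generalize (Finset.univ.inf' hP fun k =>
      -(E.mulVec xbar k + (Fr F).mulVec ybar k) + b k + ν k) = s at hφ hsk hs0 hsφ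
    have hG0 : 0 ≤ G := (Real.sqrt_nonneg _).trans hGk
    have hqpos : 0 < Real.sqrt (δ / (2 * α)) := Real.sqrt_pos.2 (by positivity)
    have hq2 : δ = 2 * α * Real.sqrt (δ / (2 * α)) ^ 2 := by
      rw [Real.sq_sqrt (by positivity)]; field_simp
    have hqx : 0 ≤ ∑ i, x i ^ 2 + ∑ j, y j ^ 2 := by positivity
    have hqxb : 0 ≤ ∑ i, xbar i ^ 2 + ∑ j, ybar j ^ 2 := by positivity
    have hN0 : 0 ≤ a ⬝ᵥ xbar + d ⬝ᵥ ybar + α / 2 * (∑ i, xbar i ^ 2 + ∑ j, ybar j ^ 2)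
            + Real.sqrt (∑ i, a i ^ 2 + ∑ j, d j ^ 2) * r := by
      have : 0 ≤ α / 2 * (∑ i, xbar i ^ 2 + ∑ j, ybar j ^ 2) := by positivity
      linarith
    have hφ0 : 0 ≤ φ := by rw [hφ]; positivity
    have hQ : 0 ≤ ∑ i, (xbar i - x i) ^ 2 + ∑ j, (ybar j - y j) ^ 2 := by positivity
    -- gradient bound
    have hdiff : (E.mulVec x k + (Fr F).mulVec y k) - (E.mulVec xbar k + (Fr F).mulVec ybar k) ≤
        G * Real.sqrt (∑ i, (xbar i - x i) ^ 2 + ∑ j, (ybar j - y j) ^ 2) := by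
      have h1 := (abs_le.1 (aux_cs (E k) (fun i => xbar i - x i) (fun j => (F k j : ℝ))
        (fun j => ybar j - y j))).1
      have h2 := mul_le_mul_of_nonneg_right hGk
        (Real.sqrt_nonneg (∑ i, (xbar i - x i) ^ 2 + ∑ j, (ybar j - y j) ^ 2))
      simp only [mul_sub, Finset.sum_sub_distrib] at h1
      simp only [Matrix.mulVec, dotProduct, Fr, Matrix.of_apply]
      linarith
    have hvk : φ < E.mulVec x k + (Fr F).mulVec y k - b k - ν k + φ := by linarith
    refine aux_scalar G _ s φ _ (E.mulVec x k + (Fr F).mulVec y k - b k - ν k + φ) (lamhat k)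
      (Real.sqrt (∑ i, (xbar i - x i) ^ 2 + ∑ j, (ybar j - y j) ^ 2)) α δ hα hqpos hq2 hG0 hN0
      hs0 hφ hsφ hvk ((hlam k).2 (by linarith)) (by linarith) ?_
    rw [Real.sq_sqrt hQ]
    have hsum : lamhat k * (E.mulVec x k + (Fr F).mulVec y k - b k - ν k + φ + s - φ) ≤
        ∑ k, lamhat k * (E.mulVec x k + (Fr F).mulVec y k - b k - ν k + φ)
        - ∑ k, lamhat k * (E.mulVec xbar k + (Fr F).mulVec ybar k - b k - ν k + φ) := by
      rw [← Finset.sum_sub_distrib]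
      have h1 := Finset.single_le_sum (s := Finset.univ) (f := fun k =>
        lamhat k * (E.mulVec x k + (Fr F).mulVec y k - b k - ν k + φ)
        - lamhat k * (E.mulVec xbar k + (Fr F).mulVec ybar k - b k - ν k + φ)) (by
          intro i _
          have h1 := (hlam i).1
          have h2 := hSlaterTight i
          have h3 : 0 ≤ lamhat i * -(E.mulVec xbar i + (Fr F).mulVec ybar i - b i - ν i + φ) :=
            mul_nonneg (hlamhat i) (by linarith)
          linarith) (Finset.mem_univ k)
      refine le_trans ?_ h1
      rw [← mul_sub]
      exact mul_le_mul_of_nonneg_left (by linarith) (hlamhat k)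
    simp only [Lkprod] at hstrong
    have : 0 ≤ α / 2 * (∑ i, x i ^ 2 + ∑ j, y j ^ 2) := by positivity
    linarith
  exact ⟨hM, fun yr hyr => aux_round X E F h yl yu ξ hξ1 zhat hM yr hyr⟩
end
end

section
/- Existence of Hoffman constants: let C ∈ ℝ^{p×n}, D ∈ ℝ^{p×m}, b ∈ ℝ^p, and suppose the polyhedron P = {(x,y) ∈ ℝ^n × ℝ^m : Cx + Dy ≤ b} is nonempty. Then there exists a constant σ = σ(C,D) ≥ 0, depending only on C and D, such that for all (u,v) ∈ ℝ^n × ℝ^m, min_{(x,y)∈P} ‖(x,y) − (u,v)‖_2 ≤ σ · ‖(Cu + Dv − b)_+‖_2, where (w)_+ = max{0, w} componentwise. -/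
open Matrix Finset

noncomputable section

/-- The cone generated by the vectors `a k`, `k ∈ S`. -/
def coneS {ι E : Type*} [Fintype ι] [AddCommGroup E] [Module ℝ E] (a : ι → E) (S : Finset ι) :
    Set E :=
  {x | ∃ l : ι → ℝ, (∀ k, 0 ≤ l k) ∧ (∀ k, k ∉ S → l k = 0) ∧ ∑ k, l k • a k = x}

/-- Linear independence of the `a k`, `k ∈ J`, in a convenient form. -/
def IndepS {ι E : Type*} [Fintype ι] [AddCommGroup E] [Module ℝ E] (a : ι → E) (J : Finset ι) :
    Prop :=
  ∀ l : ι → ℝ, (∀ k, k ∉ J → l k = 0) → ∑ k, l k • a k = 0 → l = 0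

theorem cone_carath {ι E : Type*} [Fintype ι] [DecidableEq ι] [AddCommGroup E] [Module ℝ E]
    (a : ι → E) (x : E) (S : Finset ι) (hx : x ∈ coneS a S) :
    ∃ J, J ⊆ S ∧ IndepS a J ∧ x ∈ coneS a J := by
  induction S using Finset.strongInduction with
  | H S ih =>
    by_cases hS : IndepS a S
    · exact ⟨S, Finset.Subset.refl _, hS, hx⟩
    have key : ∃ g : ι → ℝ, (∀ k, k ∉ S → g k = 0) ∧ ∑ k, g k • a k = 0 ∧ ∃ k, 0 < g k := by
      unfold IndepS at hS
      push Not at hS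
      obtain ⟨g, h1, h2, h3⟩ := hS
      obtain ⟨k, hk⟩ := Function.ne_iff.1 h3
      rcases lt_or_gt_of_ne hk with h | h
      · refine ⟨fun k => - g k, fun k hk => by simp [h1 k hk], ?_, k, by simpa using h⟩
        simp [neg_smul, h2]
      · exact ⟨g, h1, h2, k, h⟩
    obtain ⟨g, h1, h2, k0, hk0⟩ := key
    obtain ⟨l, l0, lS, lx⟩ := hx
    obtain ⟨i, hi, hmin⟩ := (univ.filter fun k => 0 < g k).exists_min_image (fun k => l k / g k)
      ⟨k0, by simp [hk0]⟩
    have hgi : 0 < g i := by simpa using hi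
    have hiS : i ∈ S := by
      by_contra h
      exact hgi.ne' (h1 i h)
    have hmem : x ∈ coneS a (S.erase i) := by
      refine ⟨fun k => l k - l i / g i * g k, ?_, ?_, ?_⟩
      · intro k
        have hq : 0 ≤ l i / g i := div_nonneg (l0 i) hgi.le
        rcases lt_or_ge 0 (g k) with h | h
        · have := hmin k (by simp [h])
          rw [le_div_iff₀ h] at this
          simp only
          linarith
        · have := mul_nonneg hq (neg_nonneg.2 h)
          have := l0 k
          simp only
          linarith
      · intro k hk
        by_cases hki : k = i
        · subst hki
          simp [hgi.ne']
        · have : k ∉ S := fun h => hk (Finset.mem_erase.2 ⟨hki, h⟩)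
          simp [h1 k this, lS k this]
      · simp only [sub_smul, mul_smul, Finset.sum_sub_distrib, ← Finset.smul_sum, h2, lx]
        simp
    obtain ⟨J, hJ, hI, hxJ⟩ := ih _ (Finset.erase_ssubset hiS) hmem
    exact ⟨J, hJ.trans (Finset.erase_subset _ _), hI, hxJ⟩

/-- Coefficient vectors supported on `J`. -/
def suppSub {ι : Type*} [Fintype ι] (J : Finset ι) : Submodule ℝ (EuclideanSpace ℝ ι) where
  carrier := {l | ∀ k, k ∉ J → l k = 0}
  add_mem' := by
    intro x y hx hy k hk
    simp [hx k hk, hy k hk]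
  zero_mem' := by
    intro k _
    simp
  smul_mem' := by
    intro c x hx k hk
    simp [hx k hk]

/-- The linear combination map. -/
def combMap {ι E : Type*} [Fintype ι] [AddCommGroup E] [Module ℝ E] (a : ι → E) (J : Finset ι) :
    suppSub J →ₗ[ℝ] E where
  toFun l := ∑ k, (l : EuclideanSpace ℝ ι) k • a k
  map_add' x y := by simp [add_smul, Finset.sum_add_distrib]
  map_smul' c x := by simp [mul_smul, Finset.smul_sum]

theorem combMap_ker {ι E : Type*} [Fintype ι] [AddCommGroup E] [Module ℝ E] (a : ι → E)
    (J : Finset ι) (h : IndepS a J) : LinearMap.ker (combMap a J) = ⊥ := by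
  rw [LinearMap.ker_eq_bot']
  intro l hl
  have := h (fun k => (l : EuclideanSpace ℝ ι) k) l.2 hl
  ext k
  simpa using congrFun this k

theorem combMap_bound {ι E : Type*} [Fintype ι] [NormedAddCommGroup E] [InnerProductSpace ℝ E]
    [FiniteDimensional ℝ E] (a : ι → E) (J : Finset ι) (h : IndepS a J) :
    ∃ c : ℝ, 0 ≤ c ∧ ∀ l : suppSub J, ‖l‖ ≤ c * ‖combMap a J l‖ := by
  obtain ⟨K, _, hK⟩ := (combMap a J).exists_antilipschitzWith (combMap_ker a J h)
  refine ⟨K, K.2, fun l => ?_⟩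
  simpa using hK.le_mul_dist l 0

theorem cone_indep_closed {ι E : Type*} [Fintype ι] [NormedAddCommGroup E] [InnerProductSpace ℝ E]
    [FiniteDimensional ℝ E] (a : ι → E) (J : Finset ι) (h : IndepS a J) :
    IsClosed (coneS a J) := by
  have he := LinearMap.isClosedEmbedding_of_injective (combMap_ker a J h)
  have hc : IsClosed {l : suppSub J | ∀ k, 0 ≤ (l : EuclideanSpace ℝ ι) k} := by
    simp only [Set.ofPred_forall]
    refine isClosed_iInter fun k => isClosed_le continuous_const ?_
    fun_prop
  convert he.isClosedMap _ hc using 1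
  ext x
  constructor
  · rintro ⟨l, h0, hS, hx⟩
    exact ⟨⟨WithLp.toLp 2 l, hS⟩, h0, hx⟩
  · rintro ⟨l, h0, hx⟩
    exact ⟨fun k => (l : EuclideanSpace ℝ ι) k, h0, l.2, hx⟩

theorem cone_closed {ι E : Type*} [Fintype ι] [DecidableEq ι] [NormedAddCommGroup E]
    [InnerProductSpace ℝ E] [FiniteDimensional ℝ E] (a : ι → E) (S : Finset ι) :
    IsClosed (coneS a S) := by
  have : coneS a S = ⋃ J ∈ {J : Finset ι | J ⊆ S ∧ IndepS a J}, coneS a J := by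
    ext x
    simp only [Set.mem_iUnion]
    constructor
    · intro hx
      obtain ⟨J, h1, h2, h3⟩ := cone_carath a x S hx
      exact ⟨J, ⟨h1, h2⟩, h3⟩
    · rintro ⟨J, ⟨h1, h2⟩, l, h3, h4, h5⟩
      exact ⟨l, h3, fun k hk => h4 k fun h => hk (h1 h), h5⟩
  rw [this]
  exact (Set.toFinite _).isClosed_biUnion fun J hJ => cone_indep_closed a J hJ.2

/-- The cone as a proper cone. -/
def coneP {ι E : Type*} [Fintype ι] [DecidableEq ι] [NormedAddCommGroup E]
    [InnerProductSpace ℝ E] [FiniteDimensional ℝ E] (a : ι → E) (S : Finset ι) :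
    ProperCone ℝ E where
  carrier := coneS a S
  add_mem' := by
    rintro x y ⟨l, h1, h2, rfl⟩ ⟨l', h1', h2', rfl⟩
    refine ⟨l + l', fun k => add_nonneg (h1 k) (h1' k), fun k hk => ?_, ?_⟩
    · simp [h2 k hk, h2' k hk]
    · simp [add_smul, Finset.sum_add_distrib]
  zero_mem' := ⟨0, fun k => le_rfl, fun k _ => rfl, by simp⟩
  smul_mem' := by
    rintro c x ⟨l, h1, h2, rfl⟩
    refine ⟨fun k => c * l k, fun k => mul_nonneg c.2 (h1 k), fun k hk => ?_, ?_⟩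
    · simp [h2 k hk]
    · simp only [mul_smul, ← Finset.smul_sum]
      rfl
  isClosed' := cone_closed a S

theorem farkasS {ι E : Type*} [Fintype ι] [DecidableEq ι] [NormedAddCommGroup E]
    [InnerProductSpace ℝ E] [FiniteDimensional ℝ E] (a : ι → E) (S : Finset ι) (g : E)
    (h : ∀ d : E, (∀ k ∈ S, inner ℝ (a k) d ≤ 0) → inner ℝ g d ≤ 0) : g ∈ coneS a S := by
  by_contra hg
  have hg' : g ∉ coneP a S := hg
  obtain ⟨y, hy, hgy⟩ := ProperCone.hyperplane_separation' (coneP a S) hg'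
  have := h (-y) (fun k hk => by
    have : 0 ≤ inner ℝ (a k) y := by
      apply hy
      refine ⟨Pi.single k 1, fun j => ?_, fun j hj => ?_, ?_⟩
      · by_cases hjk : j = k
        · subst hjk
          simp
        · simp [hjk]
      · have : j ≠ k := fun e => hj (e ▸ hk)
        simp [this]
      · simp [Pi.single_apply, ite_smul]
    simpa using this)
  rw [inner_neg_right] at this
  linarith

theorem hoffman_abs {ι E : Type*} [Fintype ι] [DecidableEq ι] [NormedAddCommGroup E]
    [InnerProductSpace ℝ E] [FiniteDimensional ℝ E] (a : ι → E) :
    ∃ σ : ℝ, 0 ≤ σ ∧ ∀ b : ι → ℝ, (∃ z, ∀ k, inner ℝ (a k) z ≤ b k) → ∀ w : E,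
      ∃ z, (∀ k, inner ℝ (a k) z ≤ b k) ∧
        (∀ z', (∀ k, inner ℝ (a k) z' ≤ b k) → ‖w - z‖ ≤ ‖w - z'‖) ∧
        ‖w - z‖ ≤ σ * Real.sqrt (∑ k, (max 0 (inner ℝ (a k) w - b k)) ^ 2) := by
  have hc : ∀ J : Finset ι, ∃ c : ℝ, 0 ≤ c ∧
      (IndepS a J → ∀ l : suppSub J, ‖l‖ ≤ c * ‖combMap a J l‖) := by
    intro J
    by_cases h : IndepS a J
    · obtain ⟨c, h0, h1⟩ := combMap_bound a J h
      exact ⟨c, h0, fun _ => h1⟩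
    · exact ⟨0, le_rfl, fun h' => absurd h' h⟩
  choose c c0 hcb using hc
  refine ⟨∑ J, c J, Finset.sum_nonneg fun J _ => c0 J, ?_⟩
  rintro b ⟨z0, hz0⟩ w
  set P : Set E := {z | ∀ k, inner ℝ (a k) z ≤ b k} with hP
  have hPc : IsClosed P := by
    simp only [hP, Set.ofPred_forall]
    refine isClosed_iInter fun k => isClosed_le ?_ continuous_const
    fun_prop
  have hPconv : Convex ℝ P := by
    intro x hx y hy s t hs ht hst k
    have h1 := mul_le_mul_of_nonneg_left (hx k) hs
    have h2 := mul_le_mul_of_nonneg_left (hy k) ht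
    rw [inner_add_right, inner_smul_right, inner_smul_right]
    calc _ ≤ s * b k + t * b k := add_le_add h1 h2
      _ = b k := by rw [← add_mul, hst, one_mul]
  obtain ⟨z, hz, hzmin⟩ := exists_norm_eq_iInf_of_complete_convex (K := P) ⟨z0, hz0⟩ hPc.isComplete hPconv w
  have hvar := (norm_eq_iInf_iff_real_inner_le_zero hPconv hz).1 hzmin
  refine ⟨z, hz, ?_, ?_⟩
  · intro z' hz'
    rw [hzmin]
    exact ciInf_le (f := fun w' : P => ‖w - w'‖)
      ⟨0, Set.forall_mem_range.2 fun _ => norm_nonneg _⟩ ⟨z', hz'⟩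
  set S : Finset ι := univ.filter fun k => inner ℝ (a k) z = b k with hS
  have hcone : w - z ∈ coneS a S := by
    apply farkasS
    intro d hd
    have hev : ∀ᶠ t : ℝ in nhdsWithin 0 (Set.Ioi 0), z + t • d ∈ P := by
      simp only [hP, Set.mem_ofPred_eq, Filter.eventually_all]
      intro k
      by_cases hk : inner ℝ (a k) z = b k
      · filter_upwards [self_mem_nhdsWithin] with t ht
        have h1 := hd k (by simp [hS, hk])
        rw [inner_add_right, inner_smul_right, hk]
        have := mul_nonneg (le_of_lt (Set.mem_Ioi.1 ht)) (neg_nonneg.2 h1)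
        linarith
      · have hlt : inner ℝ (a k) z < b k := lt_of_le_of_ne (hz k) hk
        have hcont : ContinuousAt (fun t : ℝ => inner ℝ (a k) (z + t • d)) 0 := by fun_prop
        have := hcont.eventually_lt (continuousAt_const (y := b k)) (by simpa using hlt)
        exact (this.filter_mono nhdsWithin_le_nhds).mono fun t ht => ht.le
    obtain ⟨t, ht, ht0⟩ := (hev.and self_mem_nhdsWithin).exists
    have := hvar _ ht
    rw [add_sub_cancel_left, inner_smul_right] at this
    exact nonpos_of_mul_nonpos_right this ht0
  obtain ⟨J, hJS, hJ, l, l0, lJ, hl⟩ := cone_carath a _ S hcone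
  have hnorm := hcb J hJ ⟨WithLp.toLp 2 l, lJ⟩
  have hval : combMap a J ⟨WithLp.toLp 2 l, lJ⟩ = w - z := hl
  rw [hval] at hnorm
  have hn2 : ‖(⟨WithLp.toLp 2 l, lJ⟩ : suppSub J)‖ = Real.sqrt (∑ k, l k ^ 2) := by
    rw [Submodule.coe_norm, EuclideanSpace.norm_eq]
    simp
  rw [hn2] at hnorm
  set R := Real.sqrt (∑ k, (max 0 (inner ℝ (a k) w - b k)) ^ 2) with hR
  have hsq : ‖w - z‖ ^ 2 ≤ Real.sqrt (∑ k, l k ^ 2) * R := by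
    calc ‖w - z‖ ^ 2 = inner ℝ (∑ k, l k • a k) (w - z) := by
          rw [hl, real_inner_self_eq_norm_sq]
      _ = ∑ k, l k * inner ℝ (a k) (w - z) := by
          simp [sum_inner, inner_smul_left]
      _ ≤ ∑ k, l k * max 0 (inner ℝ (a k) w - b k) := by
          refine Finset.sum_le_sum fun k _ => ?_
          by_cases hk : k ∈ J
          · have : inner ℝ (a k) z = b k := by simpa [hS] using hJS hk
            rw [inner_sub_right, this]
            exact mul_le_mul_of_nonneg_left (le_max_right _ _) (l0 k)
          · simp [lJ k hk]
      _ ≤ _ := Real.sum_mul_le_sqrt_mul_sqrt _ _ _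
  have hR0 : 0 ≤ R := Real.sqrt_nonneg _
  have hle : ‖w - z‖ ≤ c J * R := by
    rcases (norm_nonneg (w - z)).eq_or_lt with h | h
    · rw [← h]
      exact mul_nonneg (c0 J) hR0
    · have := mul_le_mul_of_nonneg_right hnorm hR0
      refine le_of_mul_le_mul_right ?_ h
      nlinarith
  exact hle.trans (mul_le_mul_of_nonneg_right
    (Finset.single_le_sum (fun J _ => c0 J) (Finset.mem_univ J)) hR0)

/-- Existence of Hoffman constants: for `C ∈ ℝ^{p×n}`, `D ∈ ℝ^{p×m}`
there is a constant `σ ≥ 0`, depending only on `C` and `D`, such that for every `b` for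
which the polyhedron `P = {(x,y) : Cx + Dy ≤ b}` is nonempty and every `(u,v)`, the
(attained) distance from `(u,v)` to `P` is at most `σ‖(Cu + Dv − b)₊‖₂`. -/
theorem hoffman_exists {p n m : ℕ} (C : Matrix (Fin p) (Fin n) ℝ)
    (D : Matrix (Fin p) (Fin m) ℝ) :
    ∃ σ : ℝ, 0 ≤ σ ∧ ∀ b : Fin p → ℝ,
      (∃ x : Fin n → ℝ, ∃ y : Fin m → ℝ, ∀ k, C.mulVec x k + D.mulVec y k ≤ b k) →
      ∀ (u : Fin n → ℝ) (v : Fin m → ℝ),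
        ∃ (x : Fin n → ℝ) (y : Fin m → ℝ),
          (∀ k, C.mulVec x k + D.mulVec y k ≤ b k) ∧
          (∀ (x' : Fin n → ℝ) (y' : Fin m → ℝ), (∀ k, C.mulVec x' k + D.mulVec y' k ≤ b k) →
            Real.sqrt (∑ i, (x i - u i) ^ 2 + ∑ j, (y j - v j) ^ 2) ≤
              Real.sqrt (∑ i, (x' i - u i) ^ 2 + ∑ j, (y' j - v j) ^ 2)) ∧
          Real.sqrt (∑ i, (x i - u i) ^ 2 + ∑ j, (y j - v j) ^ 2) ≤
            σ * Real.sqrt (∑ k, (max 0 (C.mulVec u k + D.mulVec v k - b k)) ^ 2) := by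
  obtain ⟨σ, h0, hσ⟩ := hoffman_abs (E := EuclideanSpace ℝ (Fin n ⊕ Fin m))
    (fun k => WithLp.toLp 2 (Sum.elim (C k) (D k)))
  have hin : ∀ k (z : EuclideanSpace ℝ (Fin n ⊕ Fin m)),
      inner ℝ (WithLp.toLp 2 (Sum.elim (C k) (D k)) : EuclideanSpace ℝ (Fin n ⊕ Fin m)) z =
        C.mulVec (fun i => z (Sum.inl i)) k + D.mulVec (fun j => z (Sum.inr j)) k := by
    intro k z
    simp [PiLp.inner_apply, Matrix.mulVec, dotProduct, mul_comm]
  have hnm : ∀ w z : EuclideanSpace ℝ (Fin n ⊕ Fin m), ‖w - z‖ =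
      Real.sqrt (∑ i, (z (Sum.inl i) - w (Sum.inl i)) ^ 2 +
        ∑ j, (z (Sum.inr j) - w (Sum.inr j)) ^ 2) := by
    intro w z
    rw [norm_sub_rev, EuclideanSpace.norm_eq]
    simp
  simp only [hin, hnm] at hσ
  refine ⟨σ, h0, ?_⟩
  rintro b ⟨x0, y0, h⟩ u v
  obtain ⟨z, h1, h2, h3⟩ := hσ b ⟨WithLp.toLp 2 (Sum.elim x0 y0), h⟩
    (WithLp.toLp 2 (Sum.elim u v))
  exact ⟨fun i => z (Sum.inl i), fun j => z (Sum.inr j), h1,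
    fun x' y' h' => h2 (WithLp.toLp 2 (Sum.elim x' y')) h', h3⟩
end
end
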